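/- Assume Setup (T). Then p^m · (P^{-1}) = −(p^m · P), where P^{-1} is the inverse of P in the group (A,∘) and p^m · x denotes the p^m-fold additive multiple. -/

import Mathlib

/-- A (left) brace: an abelian group `(A,+)` and a group `(A,∘)` (written `*`)
on the same underlying set, with `a∘(b+c)+a = a∘b+a∘c`; the identity of `(A,∘)`
coincides with `0`. -/
class Brace (A : Type*) extends AddCommGroup A, Group A where
  mul_add_left : ∀ a b c : A, a * (b + c) + a = a * b + a * c
  one_eq_zero : (1 : A) = 0

namespace Brace

variable {A : Type*} [Brace A]

/-- The star operation `a ∗ b = a∘b - a - b`. -/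
def bstar (a b : A) : A := a * b - a - b

/-- `X ∗ Y`: the additive subgroup generated by `{x∗y : x ∈ X, y ∈ Y}`. -/
def starSpan (A : Type*) [Brace A] (X Y : Set A) : AddSubgroup A :=
  AddSubgroup.closure {z : A | ∃ x ∈ X, ∃ y ∈ Y, z = bstar x y}

/-- `A² = A ∗ A`. -/
def sq (A : Type*) [Brace A] : AddSubgroup A := starSpan A Set.univ Set.univ

/-- `A³ = A ∗ A²`. -/
def cube (A : Type*) [Brace A] : AddSubgroup A := starSpan A Set.univ (sq A : Set A)

/-- The right series: `rightSeries A 0 = A^(1) = A`, `rightSeries A (n+1) = A^(n+1+1) = A^(n+1) ∗ A`. -/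
def rightSeries (A : Type*) [Brace A] : ℕ → AddSubgroup A
  | 0 => ⊤
  | n + 1 => starSpan A (rightSeries A n : Set A) Set.univ

/-- A brace is right nilpotent if `A^(n) = 0` for some `n`. -/
def RightNilpotent (A : Type*) [Brace A] : Prop := ∃ n : ℕ, rightSeries A n = ⊥

/-- `c ∈ Z(A)`: `c∗a = a∗c` for all `a`. -/
def IsCentral (c : A) : Prop := ∀ a : A, bstar c a = bstar a c

end Brace

/-- Setup (T) of the paper: `p > 5` prime, `A` a brace of cardinality `p^4` whose additive
group is `C_p × C_{p^3}` (with `m = 2`) or `C_{p^2} × C_{p^2}` (with `m = 1`), whose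
multiplicative group is generated by `{P, Q_1, …, Q_i}`, with `P^{p^m}` central and in `A²`,
each `Q_j` of order at most `p^m`, and every `a ∈ A` writable as
`P^k ∘ Q_{σ(1)}^{a_{σ(1)}} ∘ ⋯ ∘ Q_{σ(i)}^{a_{σ(i)}}` for every ordering `σ`. -/
structure SetupT (p m i : ℕ) (A : Type*) [Brace A] (P : A) (Q : Fin i → A) : Prop where
  hp : p.Prime
  hp5 : 5 < p
  hcard : Nat.card A = p ^ 4
  hadd : (Nonempty (A ≃+ ZMod p × ZMod (p ^ 3)) ∧ m = 2) ∨
         (Nonempty (A ≃+ ZMod (p ^ 2) × ZMod (p ^ 2)) ∧ m = 1)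
  hgen : Subgroup.closure ({P} ∪ Set.range Q) = ⊤
  hcentral : Brace.IsCentral (P ^ (p ^ m))
  hsq : P ^ (p ^ m) ∈ Brace.sq A
  hord : ∀ j : Fin i, orderOf (Q j) ≤ p ^ m
  hdecomp : ∀ a : A, ∀ σ : Equiv.Perm (Fin i), ∃ (k : ℤ) (e : Fin i → ℤ),
      a = P ^ k * (List.ofFn fun t : Fin i => Q (σ t) ^ e (σ t)).prod

namespace Brace

/-- The action of `(A,∘)` on `(A,+)` by `λ_a(b) = a∘b - a`. -/
def lam (A : Type*) [Brace A] : A →* AddMonoid.End A where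
  toFun a := AddMonoidHom.mk' (fun b => a * b - a) fun b c => by
    rw [← sub_eq_zero, show a * (b + c) = a * b + a * c - a from eq_sub_of_add_eq
      (mul_add_left a b c)]
    abel
  map_one' := by
    ext b
    change 1 * b - 1 = b
    rw [one_mul, one_eq_zero, sub_zero]
  map_mul' a b := by
    ext c
    change a * b * c - a * b = a * (b * c - b) - a
    have h := mul_add_left a (b * c - b) b
    rw [sub_add_cancel, ← mul_assoc] at h
    rw [sub_eq_sub_iff_add_eq_add, h, add_comm]

variable {A : Type*} [Brace A]

theorem lam_apply (a b : A) : lam A a b = a * b - a := rfl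

theorem mul_eq_add_lam (a b : A) : a * b = a + lam A a b := by
  rw [lam_apply]; abel

theorem pow_eq_geom_sum (a : A) (n : ℕ) :
    a ^ n = (∑ i ∈ Finset.range n, lam A a ^ i) a := by
  induction n with
  | zero => rw [pow_zero, one_eq_zero]; rfl
  | succ n ih =>
    rw [pow_succ, mul_eq_add_lam, Finset.sum_range_succ, map_pow]
    exact congrArg (· + (lam A a ^ n) a) ih

theorem geom_sum_eq_sum_choose {R : Type*} [Ring R] (x : R) (n : ℕ) :
    ∑ i ∈ Finset.range n, x ^ i
      = ∑ i ∈ Finset.range n, (n.choose (i + 1) : R) * (x - 1) ^ i := by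
  have h := congrArg (Polynomial.aeval (x - 1))
    (Polynomial.geom_sum_X_comp_X_add_one_eq_sum (R := ℤ) n)
  simpa [Polynomial.aeval_comp] using h

/-- If `N = x - 1` is nilpotent of degree less than `p`, the geometric sum of length `p` is
`p` times a unit. -/
theorem exists_unit_geom_sum {R : Type*} [Ring R] {p : ℕ} (hp : p.Prime) (x : R)
    (hx : (x - 1) ^ (p - 1) = 0) :
    ∃ u : Rˣ, ∑ i ∈ Finset.range p, x ^ i = (p : R) * u := by
  obtain ⟨q, rfl⟩ : ∃ q, p = q + 2 := ⟨p - 2, by have := hp.two_le; omega⟩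
  set p := q + 2 with hpq
  have hdiv : ∀ i ∈ Finset.range (q + 1),
      (p.choose (i + 1) : R) * (x - 1) ^ i = (p : R) * ((p.choose (i + 1) / p : ℕ) * (x - 1) ^ i) := by
    intro i hi
    have : p ∣ p.choose (i + 1) :=
      hp.dvd_choose_self (by omega) (by have := Finset.mem_range.1 hi; omega)
    rw [← mul_assoc, ← Nat.cast_mul, Nat.mul_div_cancel' this]
  have hnil : IsNilpotent ((∑ i ∈ Finset.range q,
      ((p.choose (i + 2) / p : ℕ) : R) * (x - 1) ^ i) * (x - 1)) := by
    refine Commute.isNilpotent_mul_left ?_ ⟨_, hx⟩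
    refine Commute.sum_left _ _ _ fun i _ => ?_
    exact (Nat.cast_commute _ _).mul_left ((Commute.refl _).pow_left _)
  obtain ⟨u, hu⟩ := hnil.isUnit_add_one
  refine ⟨u, ?_⟩
  rw [geom_sum_eq_sum_choose, hpq, Finset.sum_range_succ, ← hpq,
    show (x - 1) ^ (q + 1) = 0 from hx, mul_zero, add_zero, Finset.sum_congr rfl hdiv,
    ← Finset.mul_sum, hu, Finset.sum_range_succ', Finset.sum_mul]
  simp only [pow_zero, mul_one, zero_add, Nat.choose_one_right, Nat.div_self hp.pos, Nat.cast_one,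
    pow_succ, mul_assoc, add_assoc, Nat.reduceAdd]

theorem isNilpotent_sub_one_of_pow_eq_one {R : Type*} [Ring R] {p n k : ℕ} (hp : p.Prime) (x : R)
    (hR : (p : R) ^ k = 0) (hx : x ^ p ^ n = 1) : IsNilpotent (x - 1) := by
  obtain ⟨r, hr⟩ := (Commute.one_right (x - 1)).exists_add_pow_prime_pow_eq hp n
  rw [sub_add_cancel, hx, one_pow] at hr
  have h : (x - 1) ^ p ^ n = (p : R) * -((x - 1) * r) := by
    rw [mul_one, mul_assoc, add_right_comm, right_eq_add] at hr
    rw [mul_neg]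
    exact eq_neg_of_add_eq_zero_left hr
  refine ⟨p ^ n * k, ?_⟩
  rw [pow_mul, h, (Nat.cast_commute _ _).mul_pow, hR, zero_mul]

theorem card_range_pow_dvd {G : Type*} [AddCommGroup G] {p n : ℕ} (hp : p.Prime)
    (hG : Nat.card G = p ^ n) (f : AddMonoid.End G) (hf : IsNilpotent f) (k : ℕ) (hk : k ≤ n) :
    Nat.card (AddMonoidHom.range (f ^ k)) ∣ p ^ (n - k) := by
  have hfin : Finite G := Nat.finite_of_card_ne_zero (by rw [hG]; exact pow_ne_zero _ hp.ne_zero)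
  induction k with
  | zero => rw [Nat.sub_zero, ← hG]; exact AddSubgroup.card_addSubgroup_dvd_card _
  | succ k ih =>
    have ih := ih (by omega)
    have hle : AddMonoidHom.range (f ^ (k + 1)) ≤ AddMonoidHom.range (f ^ k) := by
      rintro _ ⟨y, rfl⟩
      exact ⟨f y, by rw [pow_succ]; rfl⟩
    have hdvd := AddSubgroup.card_dvd_of_le hle
    rcases eq_or_lt_of_le hle with heq | hlt
    · obtain ⟨m, hm⟩ := hf
      have hstab : ∀ j, AddMonoidHom.range (f ^ (k + j)) = AddMonoidHom.range (f ^ k) := by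
        intro j
        induction j with
        | zero => rfl
        | succ j ihj =>
          refine le_antisymm ?_ ?_
          · rintro _ ⟨y, rfl⟩
            exact ⟨(f ^ (j + 1)) y, by rw [pow_add f k]; rfl⟩
          · rw [← heq]
            rintro _ ⟨y, rfl⟩
            have hy : (f ^ k) y ∈ AddMonoidHom.range (f ^ (k + j)) := by
              rw [ihj]; exact ⟨y, rfl⟩
            obtain ⟨z, hz⟩ := hy
            refine ⟨z, ?_⟩
            rw [← add_assoc, pow_succ', pow_succ']
            exact congrArg f hz
      have hbot : AddMonoidHom.range (f ^ k) = ⊥ := by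
        rw [← hstab m, pow_add, hm, mul_zero]
        exact AddMonoidHom.range_zero
      rw [heq, hbot]
      simp
    · obtain ⟨i, hi, hci⟩ := (Nat.dvd_prime_pow hp).1 ih
      obtain ⟨j, hj, hcj⟩ := (Nat.dvd_prime_pow hp).1 (hdvd.trans ih)
      rw [hcj]
      refine pow_dvd_pow _ ?_
      by_contra hcon
      have hij : i ≤ j := by omega
      refine hlt.ne (AddSubgroup.eq_of_le_of_card_ge hle ?_)
      rw [hci, hcj]
      exact Nat.pow_le_pow_right hp.pos hij

theorem pow_eq_zero_of_isNilpotent {G : Type*} [AddCommGroup G] {p n : ℕ} (hp : p.Prime)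
    (hG : Nat.card G = p ^ n) (f : AddMonoid.End G) (hf : IsNilpotent f) : f ^ n = 0 := by
  have h := card_range_pow_dvd hp hG f hf n le_rfl
  rw [Nat.sub_self, pow_zero, Nat.dvd_one, AddSubgroup.card_eq_one] at h
  ext y
  have hy : (f ^ n) y ∈ AddMonoidHom.range (f ^ n) := ⟨y, rfl⟩
  rw [h] at hy
  exact hy

theorem natCast_end_apply {G : Type*} [AddCommGroup G] (n : ℕ) (y : G) :
    (n : AddMonoid.End G) y = n • y := rfl

theorem lam_sub_one_isNilpotent {p n : ℕ} (hp : p.Prime) (hA : Nat.card A = p ^ n) (a : A) :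
    IsNilpotent (lam A a - 1) := by
  refine isNilpotent_sub_one_of_pow_eq_one (n := n) (k := n) hp _ ?_ ?_
  · ext y
    rw [← Nat.cast_pow, natCast_end_apply, ← hA, card_nsmul_eq_zero']
    rfl
  · rw [← map_pow, ← hA, pow_card_eq_one', map_one]

theorem exists_unit_pow_prime {p n : ℕ} (hp : p.Prime) (hA : Nat.card A = p ^ n) (hn : n < p)
    (a : A) : ∃ u : (AddMonoid.End A)ˣ, a ^ p = p • (u : AddMonoid.End A) a := by
  obtain ⟨u, hu⟩ := exists_unit_geom_sum hp (lam A a) (pow_eq_zero_of_le (by omega)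
    (pow_eq_zero_of_isNilpotent hp hA _ (lam_sub_one_isNilpotent hp hA a)))
  exact ⟨u, by rw [pow_eq_geom_sum, hu]; rfl⟩

theorem nsmul_eq_zero_of_pow_eq_one {p n : ℕ} (hp : p.Prime) (hA : Nat.card A = p ^ n)
    (hn : n < p) {a : A} (ha : a ^ p = 1) : p • a = 0 := by
  obtain ⟨u, hu⟩ := exists_unit_pow_prime hp hA hn a
  rw [ha, one_eq_zero, ← map_nsmul] at hu
  have h := congrArg (↑u⁻¹ : AddMonoid.End A) hu
  rw [map_zero] at h
  exact (h.trans (DFunLike.congr_fun u.inv_mul (p • a))).symm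

/-- The `n`-torsion of `(A,+)`, as a subgroup of `(A,∘)`. -/
def torsion (A : Type*) [Brace A] (n : ℕ) : Subgroup A where
  carrier := {a | n • a = 0}
  one_mem' := by
    change n • (1 : A) = 0
    rw [one_eq_zero, smul_zero]
  mul_mem' {a b} ha hb := by
    change n • (a * b) = 0
    rw [mul_eq_add_lam, smul_add, ← map_nsmul, show n • a = 0 from ha, show n • b = 0 from hb,
      map_zero, add_zero]
  inv_mem' {a} ha := by
    change n • a⁻¹ = 0
    have h := mul_eq_add_lam a⁻¹ a
    rw [inv_mul_cancel, one_eq_zero, eq_comm, add_eq_zero_iff_eq_neg] at h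
    rw [h, smul_neg, ← map_nsmul, show n • a = 0 from ha, map_zero, neg_zero]

theorem nsmul_mul_of_mem_torsion {n : ℕ} (a : A) {b : A} (hb : b ∈ torsion A n) :
    n • (a * b) = n • a := by
  rw [mul_eq_add_lam, smul_add, ← map_nsmul, show n • b = 0 from hb, map_zero, add_zero]

/-- If `(A,+) ≅ C_p × C_{p^3}`, then `p^2 A` has order `p` and every `λ_a` fixes it pointwise. -/
theorem lam_sq_nsmul {p : ℕ} (hp : p.Prime) (hA : Nat.card A = p ^ 4)
    (e : A ≃+ ZMod p × ZMod (p ^ 3)) (a y : A) : lam A a (p ^ 2 • y) = p ^ 2 • y := by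
  have : NeZero (p ^ 3) := ⟨pow_ne_zero _ hp.ne_zero⟩
  set g : A := p ^ 2 • e.symm (0, 1) with hg
  have hmul : ∀ z : A, ∃ t : ℕ, p ^ 2 • z = t • g := by
    intro z
    refine ⟨(e z).2.val, e.injective ?_⟩
    simp only [hg, map_nsmul, AddEquiv.apply_symm_apply]
    ext
    · simp [pow_two]
    · simp [mul_comm]
  have hpg : p • g = 0 := by
    apply e.injective
    simp only [hg, map_nsmul, AddEquiv.apply_symm_apply, map_zero]
    ext
    · simp
    · simp only [Prod.smul_mk, Prod.snd_zero, nsmul_one]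
      rw [nsmul_eq_mul, ← Nat.cast_mul, ← pow_succ']
      exact ZMod.natCast_self _
  have hg0 : g ≠ 0 := by
    intro h0
    have h1 := congrArg (fun z => (e z).2) h0
    simp only [hg, map_nsmul, AddEquiv.apply_symm_apply, map_zero, Prod.smul_mk, Prod.snd_zero,
      nsmul_one, ZMod.natCast_eq_zero_iff] at h1
    have := (Nat.pow_dvd_pow_iff_le_right hp.one_lt).1 h1
    omega
  set N := lam A a - 1 with hN
  obtain ⟨t, ht⟩ : ∃ t : ℕ, N g = t • g := by
    obtain ⟨t, ht⟩ := hmul (N (e.symm (0, 1)))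
    exact ⟨t, by rw [← ht, hg, map_nsmul]⟩
  have hpow : ∀ k : ℕ, (N ^ k) g = t ^ k • g := by
    intro k
    induction k with
    | zero => simp
    | succ k ih => rw [pow_succ', pow_succ, mul_smul, ← ht, ← map_nsmul, ← ih]; rfl
  have hord : addOrderOf g = p := by
    have := Fact.mk hp
    exact addOrderOf_eq_prime hpg hg0
  obtain ⟨k, hk⟩ := lam_sub_one_isNilpotent hp hA a
  have htk := hpow k
  rw [hk, eq_comm, show (0 : AddMonoid.End A) g = 0 from rfl, ← addOrderOf_dvd_iff_nsmul_eq_zero, hord] at htk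
  have hNg : N g = 0 := by
    rw [ht, ← addOrderOf_dvd_iff_nsmul_eq_zero, hord]
    exact hp.dvd_of_dvd_pow htk
  obtain ⟨s, hs⟩ := hmul y
  have hfix : lam A a g = g := sub_eq_zero.1 hNg
  rw [hs, map_nsmul, hfix]

end Brace

open Brace in
/-- The homocyclic case of the setup does not occur. -/
theorem SetupT.not_homocyclic {p i : ℕ} {A : Type*} [Brace A] {P : A} {Q : Fin i → A}
    (h : SetupT p 1 i A P Q) (e : A ≃+ ZMod (p ^ 2) × ZMod (p ^ 2)) : False := by
  have hp := h.hp
  have hlt : 4 < p := by have := h.hp5; omega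
  have hQ : ∀ j, Q j ∈ torsion A p := by
    intro j
    refine nsmul_eq_zero_of_pow_eq_one hp h.hcard hlt ?_
    obtain ⟨n, -, hn⟩ := (Nat.dvd_prime_pow hp).1 (h.hcard ▸ orderOf_dvd_natCard (Q j))
    have hle := h.hord j
    rw [hn] at hle
    refine orderOf_dvd_iff_pow_eq_one.1 ?_
    have h1 := (Nat.pow_le_pow_iff_right hp.one_lt).1 hle
    rw [hn]
    simpa using pow_dvd_pow p h1
  have hPp : P ^ p ∈ torsion A p := by
    obtain ⟨u, hu⟩ := exists_unit_pow_prime hp h.hcard hlt P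
    change p • P ^ p = 0
    rw [hu, smul_smul, ← pow_two]
    apply e.injective
    rw [map_nsmul, map_zero]
    ext
    · rw [Prod.smul_fst, nsmul_eq_mul, ZMod.natCast_self, zero_mul, Prod.fst_zero]
    · rw [Prod.smul_snd, nsmul_eq_mul, ZMod.natCast_self, zero_mul, Prod.snd_zero]
  have hrep : ∀ a : A, ∃ k : Fin p, p • a = p • P ^ (k : ℕ) := by
    intro a
    obtain ⟨k, c, rfl⟩ := h.hdecomp a 1
    have hprod : (List.ofFn fun t : Fin i =>
        Q ((1 : Equiv.Perm (Fin i)) t) ^ c ((1 : Equiv.Perm (Fin i)) t)).prod ∈ torsion A p := by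
      refine Subgroup.list_prod_mem _ fun x hx => ?_
      obtain ⟨t, rfl⟩ := (List.mem_ofFn' _ _).1 hx
      exact Subgroup.zpow_mem _ (hQ _) _
    have hp0 : (0 : ℤ) < p := by exact_mod_cast hp.pos
    have hk0 := Int.emod_nonneg k hp0.ne'
    have hk1 := Int.emod_lt_of_pos k hp0
    refine ⟨⟨(k % p).toNat, by omega⟩, ?_⟩
    have hk : P ^ k = P ^ (k % p).toNat * (P ^ p) ^ (k / p) := by
      rw [← zpow_natCast, ← zpow_natCast, ← zpow_mul, ← zpow_add, Int.toNat_of_nonneg hk0,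
        Int.emod_add_mul_ediv]
    rw [nsmul_mul_of_mem_torsion _ hprod, hk,
      nsmul_mul_of_mem_torsion _ (Subgroup.zpow_mem _ hPp _)]
  choose f hf using hrep
  have hinj : Function.Injective fun x : Fin p × Fin p =>
      f (e.symm ((x.1 : ℕ), (x.2 : ℕ))) := by
    rintro ⟨a, b⟩ ⟨c, d⟩ hxy
    have h1 := (hf (e.symm ((a : ℕ), (b : ℕ)))).trans
      ((congrArg (fun k : Fin p => p • P ^ (k : ℕ)) hxy).trans (hf (e.symm ((c : ℕ), (d : ℕ)))).symm)
    have h2 := congrArg e h1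
    simp only [map_nsmul, AddEquiv.apply_symm_apply, Prod.smul_mk, Prod.mk.injEq, nsmul_eq_mul,
      ← Nat.cast_mul] at h2
    have key : ∀ r s : Fin p, ((p * r : ℕ) : ZMod (p ^ 2)) = ((p * s : ℕ) : ZMod (p ^ 2)) →
        r = s := by
      intro r s hrs
      rw [ZMod.natCast_eq_natCast_iff, pow_two] at hrs
      have := Nat.ModEq.mul_left_cancel' hp.ne_zero hrs
      exact Fin.ext (Nat.ModEq.eq_of_lt_of_lt this r.2 s.2)
    rw [key _ _ h2.1, key _ _ h2.2]
  have hcard := Fintype.card_le_of_injective _ hinj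
  simp only [Fintype.card_prod, Fintype.card_fin] at hcard
  nlinarith

/-- under Setup (T), p^m·(P⁻¹) = −(p^m·P). -/
theorem setupT_pm_inv (p m i : ℕ) (A : Type*) [Brace A]
    (P : A) (Q : Fin i → A) (h : SetupT p m i A P Q) :
    (p ^ m) • P⁻¹ = -((p ^ m) • P) := by
  rcases h.hadd with ⟨⟨e⟩, rfl⟩ | ⟨⟨e⟩, rfl⟩
  · rw [← Brace.lam_sq_nsmul h.hp h.hcard e P P⁻¹, map_nsmul, Brace.lam_apply, mul_inv_cancel,
      Brace.one_eq_zero, zero_sub, smul_neg]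
  · exact (h.not_homocyclic e).elim
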